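/- A function f : [a,b] → ℝ is Lebesgue integrable if and only if there exists an absolutely continuous function F on [a,b] with F' = f almost everywhere; and in that case ∫ₐᵇ f dμ = F(b) − F(a). -/

import Mathlib

open Set MeasureTheory

/-- `F` is absolutely continuous on `[a, b]`: for every `ε > 0` there is `δ > 0` such that
for every finite collection of non-overlapping subintervals `[c k, d k]` of `[a, b]` with
total length `< δ`, the sum of `|F (d k) - F (c k)|` is `< ε`. -/
def AbsolutelyContinuousOn (F : ℝ → ℝ) (a b : ℝ) : Prop :=
  ∀ ε > (0 : ℝ), ∃ δ > (0 : ℝ), ∀ n : ℕ, ∀ c d : ℕ → ℝ,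
    (∀ k, k < n → a ≤ c k ∧ c k ≤ d k ∧ d k ≤ b) →
    (∀ j k, j < n → k < n → j ≠ k → Set.Ioo (c j) (d j) ∩ Set.Ioo (c k) (d k) = ∅) →
    (∑ k ∈ Finset.range n, (d k - c k)) < δ →
    (∑ k ∈ Finset.range n, |F (d k) - F (c k)|) < ε

theorem disjoint_Ioc_iff_Ioo_inter_eq_empty {p q r s : ℝ} :
    Disjoint (Ioc p q) (Ioc r s) ↔ Ioo p q ∩ Ioo r s = ∅ := by
  rw [← disjoint_iff_inter_eq_empty]
  simp only [Ioc_disjoint_Ioc, Ioo_disjoint_Ioo]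

/-- The `ε`-`δ` definition agrees with Mathlib's `AbsolutelyContinuousOnInterval`. -/
theorem absolutelyContinuousOn_iff {F : ℝ → ℝ} {a b : ℝ} (hab : a ≤ b) :
    AbsolutelyContinuousOn F a b ↔ AbsolutelyContinuousOnInterval F a b := by
  rw [absolutelyContinuousOnInterval_iff]
  refine forall₂_congr fun ε _ ↦ exists_congr fun δ ↦ and_congr_right fun _ ↦ ⟨fun h E hE hlt ↦ ?_,
    fun h n c d hcd hdisj hlt ↦ ?_⟩
  · obtain ⟨n, I⟩ := E
    obtain ⟨hmem, hdisj⟩ := hE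
    simp only [Finset.mem_range, uIcc_of_le hab, mem_Icc] at hmem
    have hsum := h n (fun k ↦ min (I k).1 (I k).2) (fun k ↦ max (I k).1 (I k).2)
      (fun k hk ↦ by grind)
      (fun j k hj hk hjk ↦ disjoint_Ioc_iff_Ioo_inter_eq_empty.mp <|
        hdisj (by simpa using hj) (by simpa using hk) hjk)
      (by simpa only [max_sub_min_eq_abs', Real.dist_eq] using hlt)
    refine lt_of_eq_of_lt (Finset.sum_congr rfl fun k _ ↦ ?_) hsum
    rcases le_total (I k).1 (I k).2 with hk | hk <;>
      simp [hk, Real.dist_eq, abs_sub_comm]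
  · have hsum := h (n, fun k ↦ (c k, d k))
      ⟨fun k hk ↦ by
        have := hcd k (Finset.mem_range.mp hk)
        simp only [uIcc_of_le hab, mem_Icc]
        grind,
      fun j hj k hk hjk ↦ by
        simp only [Finset.coe_range, mem_Iio] at hj hk
        simpa only [Function.onFun, uIoc_of_le (hcd j hj).2.1, uIoc_of_le (hcd k hk).2.1] using
          disjoint_Ioc_iff_Ioo_inter_eq_empty.mpr (hdisj j k hj hk hjk)⟩
      (lt_of_eq_of_lt (Finset.sum_congr rfl fun k hk ↦ by
        rw [dist_comm, Real.dist_eq,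
          abs_of_nonneg (sub_nonneg.mpr (hcd k (Finset.mem_range.mp hk)).2.1)]) hlt)
    simpa only [Real.dist_eq, abs_sub_comm] using hsum

/-- Descriptive definition of the Lebesgue integral: a measurable function is Lebesgue
integrable iff it is a.e. the derivative of an absolutely continuous function; and then
the integral is `F b - F a`. -/
theorem lebesgue_integrable_iff_ac_primitive (a b : ℝ) (hab : a ≤ b) (f : ℝ → ℝ)
    (hf : Measurable f) :
    (IntegrableOn f (Icc a b) volume ↔
      ∃ F : ℝ → ℝ, AbsolutelyContinuousOn F a b ∧
        ∀ᵐ x ∂(volume.restrict (Icc a b)), HasDerivAt F (f x) x) ∧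
    ∀ F : ℝ → ℝ, AbsolutelyContinuousOn F a b →
      (∀ᵐ x ∂(volume.restrict (Icc a b)), HasDerivAt F (f x) x) →
      ∫ x in Icc a b, f x = F b - F a := by
  simp only [absolutelyContinuousOn_iff hab]
  refine ⟨⟨fun hint ↦ ?_, fun ⟨F, hF, hderiv⟩ ↦ ?_⟩, fun F hF hderiv ↦ ?_⟩
  · have hint' : IntervalIntegrable f volume a b :=
      (intervalIntegrable_iff_integrableOn_Icc_of_le hab).mpr hint
    refine ⟨fun x ↦ ∫ t in a..x, f t,
      hint'.absolutelyContinuousOnInterval_intervalIntegral left_mem_uIcc, ?_⟩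
    rw [ae_restrict_iff' measurableSet_Icc]
    filter_upwards [hint'.ae_hasDerivAt_integral] with x hx hxab
    exact hx (uIcc_of_le hab ▸ hxab) a left_mem_uIcc
  · have hint := (intervalIntegrable_iff_integrableOn_Icc_of_le hab).mp hF.intervalIntegrable_deriv
    exact hint.congr (hderiv.mono fun x hx ↦ hx.deriv)
  · rw [← hF.integral_deriv_eq_sub, intervalIntegral.integral_of_le hab,
      ← integral_Icc_eq_integral_Ioc]
    exact integral_congr_ae (hderiv.mono fun x hx ↦ hx.deriv.symm)
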